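/- (Example with D = 12: the Hecke theta series of the odd ray class character φ equals η², i.e. f_φ(τ/12) = η(τ)².) For every τ in the complex upper half-plane ℍ: Σ_{λ ∈ ℤ[√3], λ > 0, 2−√3 < |λ/λ'| ≤ 2+√3} φ₀(λ) · e^{2πi |Nm(λ)| τ/12} = η(τ)², the series converging absolutely. (Since ℤ[√3] has class number one and unit group generated by −1 and 2+√3, the condition λ > 0, 2−√3 < |λ/λ'| ≤ 2+√3 selects exactly one generator of each nonzero ideal 𝔞 = (λ), and then φ₀(λ) = φ(𝔞) and |Nm(λ)| = Nm(𝔞), so the left-hand side equals Σ_{𝔞 ⊆ ℤ[√3]} φ(𝔞) q^{Nm(𝔞)/12}.) -/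

import Mathlib

open Complex Real

/-- The Dedekind eta function `η(τ) = e^{πiτ/12} ∏_{n=1}^∞ (1 − e^{2πinτ})`. -/
noncomputable def dedekindEta (τ : ℂ) : ℂ :=
  Complex.exp (Real.pi * Complex.I * τ / 12) *
    ∏' n : ℕ, (1 - Complex.exp (2 * Real.pi * Complex.I * (n + 1) * τ))

/-- The real embedding of `ℤ[√3]` sending `√3` to the positive square root of `3`. -/
noncomputable def zsqrt3ToReal (l : ℤ√3) : ℝ := l.re + l.im * Real.sqrt 3

open Classical in
/-- The function `φ₀ : ℤ[√3] → {−1,0,1}`: it is `1` if `λ ≡ 1` or `λ ≡ 2+√3 (mod 2√3)`,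
`−1` if `λ ≡ 5` or `λ ≡ 4+√3 (mod 2√3)`, and `0` otherwise. Here `2√3 = ⟨0,2⟩ ∈ ℤ√3`. -/
noncomputable def phi0 (l : ℤ√3) : ℤ :=
  if (⟨0, 2⟩ : ℤ√3) ∣ (l - 1) ∨ (⟨0, 2⟩ : ℤ√3) ∣ (l - ⟨2, 1⟩) then 1
  else if (⟨0, 2⟩ : ℤ√3) ∣ (l - 5) ∨ (⟨0, 2⟩ : ℤ√3) ∣ (l - ⟨4, 1⟩) then -1
  else 0

/-- The finite product `(q; q)_n = ∏_{k=1}^n (1 - q^k)`. -/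
noncomputable def qPoch (q : ℂ) (n : ℕ) : ℂ := ∏ k ∈ Finset.range n, (1 - q ^ (k + 1))

/-- The infinite product `(q; q)_∞`. -/
noncomputable def qPochInf (q : ℂ) : ℂ := ∏' k : ℕ, (1 - q ^ (k + 1))

/-- The function `m ↦ 1 / (q; q)_m`, extended by zero to negative integers. -/
noncomputable def qPochInv (q : ℂ) (m : ℤ) : ℂ := if 0 ≤ m then (qPoch q m.toNat)⁻¹ else 0

lemma one_sub_pow_ne_zero {q : ℂ} (hq : ‖q‖ < 1) {n : ℕ} (hn : n ≠ 0) : 1 - q ^ n ≠ 0 := by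
  intro h
  have h1 : ‖q ^ n‖ = 1 := by rw [← sub_eq_zero.mp h, norm_one]
  rw [norm_pow] at h1
  exact absurd h1 (pow_lt_one₀ (norm_nonneg _) hq hn).ne

lemma qPoch_ne_zero {q : ℂ} (hq : ‖q‖ < 1) (n : ℕ) : qPoch q n ≠ 0 :=
  Finset.prod_ne_zero_iff.mpr fun k _ => one_sub_pow_ne_zero hq k.succ_ne_zero

lemma summable_norm_pow_succ {q : ℂ} (hq : ‖q‖ < 1) : Summable fun k : ℕ => ‖-q ^ (k + 1)‖ := by
  simpa [summable_nat_add_iff] using summable_geometric_of_lt_one (norm_nonneg q) hq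

lemma qPochInf_ne_zero {q : ℂ} (hq : ‖q‖ < 1) : qPochInf q ≠ 0 := by
  have := tprod_one_add_ne_zero_of_summable (f := fun k : ℕ => -q ^ (k + 1))
    (fun k => by simpa [← sub_eq_add_neg] using one_sub_pow_ne_zero hq k.succ_ne_zero)
    (summable_norm_pow_succ hq)
  simpa [qPochInf, sub_eq_add_neg] using this

lemma tendsto_qPoch {q : ℂ} (hq : ‖q‖ < 1) :
    Filter.Tendsto (qPoch q) Filter.atTop (nhds (qPochInf q)) := by
  have h : Multipliable fun k : ℕ => 1 - q ^ (k + 1) := by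
    simpa [sub_eq_add_neg] using multipliable_one_add_of_summable (summable_norm_pow_succ hq)
  exact h.hasProd.tendsto_prod_nat

lemma qPochInv_sub_one {q : ℂ} (hq : ‖q‖ < 1) (m : ℤ) :
    qPochInv q (m - 1) = (1 - q ^ m) * qPochInv q m := by
  rcases lt_trichotomy m 0 with h | rfl | h
  · simp [qPochInv, show ¬ (0 ≤ m) by omega, show ¬ (1 ≤ m) by omega]
  · simp [qPochInv]
  · obtain ⟨n, rfl⟩ : ∃ n : ℕ, m = n + 1 := ⟨(m - 1).toNat, by omega⟩
    have h1 : ((n : ℤ) + 1).toNat = n + 1 := by omega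
    have h2 := qPoch_ne_zero hq n
    have h3 := one_sub_pow_ne_zero hq n.succ_ne_zero
    have h4 : q ^ ((n : ℤ) + 1) = q ^ (n + 1) := by norm_cast
    simp only [qPochInv, add_sub_cancel_right, Int.natCast_nonneg, if_true, Int.toNat_natCast, h1,
      show (0 : ℤ) ≤ n + 1 by omega, qPoch, Finset.prod_range_succ, h4]
    rw [qPoch] at h2
    field_simp

lemma exists_norm_qPochInv_le {q : ℂ} (hq : ‖q‖ < 1) : ∃ C, ∀ m, ‖qPochInv q m‖ ≤ C := by
  have h := (tendsto_qPoch hq).inv₀ (qPochInf_ne_zero hq)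
  obtain ⟨C, hC⟩ := h.norm.bddAbove_range
  refine ⟨C, fun m => ?_⟩
  have hC' : ∀ n, ‖(qPoch q n)⁻¹‖ ≤ C := fun n => hC ⟨n, rfl⟩
  unfold qPochInv
  split_ifs
  · exact hC' _
  · simpa using (norm_nonneg _).trans (hC' 0)

lemma tendsto_qPochInv_add {q : ℂ} (hq : ‖q‖ < 1) (k : ℤ) :
    Filter.Tendsto (fun N : ℕ => qPochInv q (N + k)) Filter.atTop (nhds (qPochInf q)⁻¹) := by
  have h := (tendsto_qPoch hq).inv₀ (qPochInf_ne_zero hq)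
  have h2 : Filter.Tendsto (fun N : ℕ => ((N : ℤ) + k).toNat) Filter.atTop Filter.atTop := by
    refine Filter.tendsto_atTop.mpr fun b => ?_
    filter_upwards [Filter.eventually_ge_atTop (b + k.natAbs)] with N hN
    omega
  refine (h.comp h2).congr' ?_
  filter_upwards [Filter.eventually_ge_atTop k.natAbs] with N hN
  simp [qPochInv, show 0 ≤ (N : ℤ) + k by omega]

/-- The coefficient of `x ^ k` in the finite Jacobi triple product. -/
noncomputable def tripleCoeff (q : ℂ) (N : ℕ) (k : ℤ) : ℂ :=
  (-1) ^ k * q ^ (k ^ 2 - k) * (qPochInv (q ^ 2) (N + k) * qPochInv (q ^ 2) (N - k))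

lemma norm_sq_lt_one {q : ℂ} (hq : ‖q‖ < 1) : ‖q ^ 2‖ < 1 := by
  rw [norm_pow]; exact pow_lt_one₀ (norm_nonneg _) hq two_ne_zero

lemma tripleCoeff_eq_zero {q : ℂ} {N : ℕ} {k : ℤ} (hk : k ∉ Finset.Icc (-(N : ℤ)) N) :
    tripleCoeff q N k = 0 := by
  rw [Finset.mem_Icc, not_and_or] at hk
  rcases hk with h | h
  · simp [tripleCoeff, qPochInv, show ¬ (0 ≤ (N : ℤ) + k) by omega]
  · simp [tripleCoeff, qPochInv, show ¬ (k ≤ (N : ℤ)) by omega]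

lemma tripleCoeff_succ {q : ℂ} (h0 : q ≠ 0) (hq : ‖q‖ < 1) (N : ℕ) (k : ℤ) :
    (1 - q ^ (4 * N + 2)) * (1 - q ^ (4 * N + 4)) * tripleCoeff q (N + 1) k =
      (1 + q ^ (4 * N + 2)) * tripleCoeff q N k - q ^ (2 * N) * tripleCoeff q N (k - 1)
        - q ^ (2 * N + 2) * tripleCoeff q N (k + 1) := by
  have hq2 := norm_sq_lt_one hq
  unfold tripleCoeff
  have e1 := qPochInv_sub_one hq2 (N + 1 + k)
  have e2 := qPochInv_sub_one hq2 (N + 1 - k)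
  have e3 := qPochInv_sub_one hq2 (N + k)
  have e4 := qPochInv_sub_one hq2 (N - k)
  rw [show (N : ℤ) + 1 + k - 1 = N + k by ring] at e1
  rw [show (N : ℤ) + 1 - k - 1 = N - k by ring] at e2
  rw [show (N : ℤ) + (k - 1) = N + k - 1 by ring, show (N : ℤ) - (k - 1) = N + 1 - k by ring,
    show (N : ℤ) + (k + 1) = N + 1 + k by ring, show (N : ℤ) - (k + 1) = N - k - 1 by ring,
    e3, e4, e1, e2]
  push_cast
  generalize qPochInv (q ^ 2) (N + 1 + k) = u
  generalize qPochInv (q ^ 2) (N + 1 - k) = v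
  have hy : q ^ k ≠ 0 := zpow_ne_zero k h0
  have hp : ∀ m : ℤ, (q ^ 2) ^ m = (q ^ m) ^ 2 := fun m => by
    rw [← zpow_natCast, ← zpow_natCast, zpow_comm]
  have g1 : q ^ ((k - 1) ^ 2 - (k - 1)) = q ^ (k ^ 2 - k) * q ^ 2 / (q ^ k) ^ 2 := by
    rw [show (k - 1) ^ 2 - (k - 1) = (k ^ 2 - k) + 2 - k - k by ring, zpow_sub₀ h0, zpow_sub₀ h0,
      zpow_add₀ h0]
    norm_cast
    field_simp
  have g2 : q ^ ((k + 1) ^ 2 - (k + 1)) = q ^ (k ^ 2 - k) * (q ^ k) ^ 2 := by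
    rw [show (k + 1) ^ 2 - (k + 1) = (k ^ 2 - k) + k + k by ring, zpow_add₀ h0, zpow_add₀ h0]
    ring
  have s1 : (-1 : ℂ) ^ (k - 1) = -(-1) ^ k := by
    rw [zpow_sub₀ (by norm_num), zpow_one]; ring
  have s2 : (-1 : ℂ) ^ (k + 1) = -(-1) ^ k := by
    rw [zpow_add₀ (by norm_num), zpow_one]; ring
  have z1 : q ^ ((N : ℤ) + 1 + k) = q ^ N * q * q ^ k := by
    rw [zpow_add₀ h0, zpow_add₀ h0, zpow_natCast, zpow_one]
  have z2 : q ^ ((N : ℤ) + 1 - k) = q ^ N * q / q ^ k := by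
    rw [zpow_sub₀ h0, zpow_add₀ h0, zpow_natCast, zpow_one]
  have z3 : q ^ ((N : ℤ) + k) = q ^ N * q ^ k := by rw [zpow_add₀ h0, zpow_natCast]
  have z4 : q ^ ((N : ℤ) - k) = q ^ N / q ^ k := by rw [zpow_sub₀ h0, zpow_natCast]
  rw [hp, hp, hp, hp, g1, g2, s1, s2, z1, z2, z3, z4]
  generalize q ^ (k ^ 2 - k) = G
  field_simp
  ring

lemma hasSum_triple_finite {q : ℂ} (h0 : q ≠ 0) (hq : ‖q‖ < 1) {x : ℂ} (hx : x ≠ 0) (N : ℕ) :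
    HasSum (fun k : ℤ => qPoch (q ^ 2) (2 * N) * tripleCoeff q N k * x ^ k)
      (∏ k ∈ Finset.range N, ((1 - x * q ^ (2 * k)) * (1 - q ^ (2 * k + 2) / x))) := by
  induction N with
  | zero =>
    have : (fun k : ℤ => qPoch (q ^ 2) (2 * 0) * tripleCoeff q 0 k * x ^ k) =
        fun k : ℤ => if k = 0 then 1 else 0 := by
      ext k
      split_ifs with h
      · subst h; simp [tripleCoeff, qPochInv, qPoch]
      · rw [tripleCoeff_eq_zero (by simpa using by omega)]; simp
    rw [this]
    simpa using hasSum_ite_eq (0 : ℤ) (1 : ℂ)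
  | succ N ih =>
    have i1 := (Equiv.subRight (1 : ℤ)).hasSum_iff.mpr ih
    have i2 := (Equiv.addRight (1 : ℤ)).hasSum_iff.mpr ih
    have := ((ih.mul_left (1 + q ^ (4 * N + 2))).sub (i1.mul_left (x * q ^ (2 * N)))).sub
      (i2.mul_left (q ^ (2 * N + 2) / x))
    rw [Finset.prod_range_succ]
    have hP (P : ℂ) : P * ((1 - x * q ^ (2 * N)) * (1 - q ^ (2 * N + 2) / x)) =
        (1 + q ^ (4 * N + 2)) * P - x * q ^ (2 * N) * P - q ^ (2 * N + 2) / x * P := by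
      field_simp
      ring
    rw [hP]
    refine (congrArg (HasSum · _) (funext fun k => ?_)).mpr this
    have hr := tripleCoeff_succ h0 hq N k
    have hE : qPoch (q ^ 2) (2 * (N + 1)) =
        qPoch (q ^ 2) (2 * N) * ((1 - q ^ (4 * N + 2)) * (1 - q ^ (4 * N + 4))) := by
      rw [show 2 * (N + 1) = 2 * N + 1 + 1 by ring, qPoch, Finset.prod_range_succ,
        Finset.prod_range_succ, ← qPoch]
      simp only [← pow_mul]
      ring_nf
    have x1 : x ^ (k - 1) = x ^ k / x := by rw [zpow_sub₀ hx, zpow_one]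
    have x2 : x ^ (k + 1) = x ^ k * x := by rw [zpow_add₀ hx, zpow_one]
    simp only [Function.comp_apply, Equiv.subRight_apply, Equiv.coe_addRight, x1, x2]
    calc _ = qPoch (q ^ 2) (2 * N) * ((1 - q ^ (4 * N + 2)) * (1 - q ^ (4 * N + 4)) *
            tripleCoeff q (N + 1) k) * x ^ k := by rw [hE]; ring
      _ = _ := by rw [hr]; field_simp

lemma summable_exp_neg_sq_add {α : ℝ} (hα : 0 < α) (β : ℝ) :
    Summable fun k : ℤ => Real.exp (-α * (k : ℝ) ^ 2 + β * k) := by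
  have h := (summable_jacobiTheta₂_term_iff (((-(β / (2 * π)) : ℝ) : ℂ) * I) ((α / π : ℝ) * I)).mpr
    (by simpa using div_pos hα pi_pos)
  refine h.norm.congr fun k => ?_
  rw [norm_jacobiTheta₂_term]
  congr 1
  simp only [mul_im, ofReal_re, I_im, ofReal_im, I_re]
  field_simp
  ring

/-- Absolute convergence of theta series. -/
lemma summable_norm_zpow_quadratic {q : ℂ} (h0 : q ≠ 0) (hq : ‖q‖ < 1) {α : ℤ} (hα : 0 < α)
    (β : ℤ) {x : ℂ} (hx : x ≠ 0) :
    Summable fun k : ℤ => ‖q ^ (α * k ^ 2 + β * k) * x ^ k‖ := by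
  have hl : Real.log ‖q‖ < 0 := Real.log_neg (norm_pos_iff.mpr h0) hq
  have ha : (0 : ℝ) < α := by exact_mod_cast hα
  refine (summable_exp_neg_sq_add (α := -(α * Real.log ‖q‖)) (by nlinarith)
    (β * Real.log ‖q‖ + Real.log ‖x‖)).congr fun k => ?_
  rw [norm_mul, norm_zpow, norm_zpow, ← Real.rpow_intCast, ← Real.rpow_intCast,
    Real.rpow_def_of_pos (norm_pos_iff.mpr h0), Real.rpow_def_of_pos (norm_pos_iff.mpr hx),
    ← Real.exp_add]
  congr 1
  push_cast
  ring

/-- **Jacobi triple product**, in the form of a limit of finite products. -/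
theorem tendsto_triple_product {q : ℂ} (h0 : q ≠ 0) (hq : ‖q‖ < 1) {x : ℂ} (hx : x ≠ 0) :
    Filter.Tendsto
      (fun N => ∏ k ∈ Finset.range N, ((1 - x * q ^ (2 * k)) * (1 - q ^ (2 * k + 2) / x)))
      Filter.atTop
      (nhds ((∑' k : ℤ, (-1) ^ k * q ^ (k ^ 2 - k) * x ^ k) / qPochInf (q ^ 2))) := by
  have hq2 := norm_sq_lt_one hq
  obtain ⟨C, hC⟩ := exists_norm_qPochInv_le hq2
  have hC0 : 0 ≤ C := (norm_nonneg _).trans (hC 0)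
  have key : Filter.Tendsto (fun N : ℕ => ∑' k : ℤ, tripleCoeff q N k * x ^ k) Filter.atTop
      (nhds (∑' k : ℤ, (-1) ^ k * q ^ (k ^ 2 - k) *
        ((qPochInf (q ^ 2))⁻¹ * (qPochInf (q ^ 2))⁻¹) * x ^ k)) := by
    refine tendsto_tsum_of_dominated_convergence
      ((summable_norm_zpow_quadratic h0 hq one_pos (-1) hx).mul_left (C * C)) (fun k => ?_) ?_
    · refine Filter.Tendsto.mul_const _ (Filter.Tendsto.const_mul _ ?_)
      refine (tendsto_qPochInv_add hq2 k).mul ?_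
      simpa [sub_eq_add_neg] using tendsto_qPochInv_add hq2 (-k)
    · filter_upwards with N k
      rw [tripleCoeff, norm_mul, norm_mul, norm_mul, norm_mul, norm_mul, norm_zpow (-1 : ℂ),
        norm_neg, norm_one, one_zpow, one_mul, mul_comm ‖q ^ _‖,
        show 1 * k ^ 2 + -1 * k = k ^ 2 - k by ring, mul_assoc]
      gcongr
      · exact hC _
      · exact hC _
  have h2 : Filter.Tendsto (fun N : ℕ => qPoch (q ^ 2) (2 * N)) Filter.atTop
      (nhds (qPochInf (q ^ 2))) :=
    (tendsto_qPoch hq2).comp (Filter.tendsto_id.const_mul_atTop' two_pos)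
  have h3 := h2.mul key
  convert h3 using 1
  · ext N
    rw [← (hasSum_triple_finite h0 hq hx N).tsum_eq, ← tsum_mul_left]
    simp only [mul_assoc]
  · congr 1
    have := qPochInf_ne_zero hq2
    rw [div_eq_mul_inv, ← tsum_mul_right, ← tsum_mul_left]
    refine tsum_congr fun k => ?_
    field_simp

/-- Gauss' product for `∑ q ^ (2 i ^ 2 - i)`. -/
theorem tsum_gauss {q : ℂ} (h0 : q ≠ 0) (hq : ‖q‖ < 1) :
    (∑' k : ℤ, q ^ (2 * k ^ 2 - k)) * qPochInf q = qPochInf (q ^ 2) ^ 2 := by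
  have hq2 := norm_sq_lt_one hq
  have hq4 : ‖(q ^ 2) ^ 2‖ < 1 := norm_sq_lt_one hq2
  have ht := tendsto_triple_product (pow_ne_zero 2 h0) hq2 (neg_ne_zero.mpr h0)
  have hs : ∀ k : ℤ, (-1) ^ k * (q ^ 2) ^ (k ^ 2 - k) * (-q) ^ k = q ^ (2 * k ^ 2 - k) := by
    intro k
    have h1 : (-1 : ℂ) ^ k * (-1) ^ k = 1 := by rw [← mul_zpow]; norm_num
    rw [← zpow_natCast q 2, ← zpow_mul, neg_eq_neg_one_mul q, mul_zpow, mul_mul_mul_comm, h1,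
      one_mul, ← zpow_add₀ h0]
    push_cast
    ring_nf
  simp only [hs] at ht
  set ψ := ∑' k : ℤ, q ^ (2 * k ^ 2 - k)
  have t {b : ℂ} (hb : ‖b‖ < 1) {c : ℕ} (hc : 0 < c) :
      Filter.Tendsto (fun N : ℕ => qPoch b (c * N)) Filter.atTop (nhds (qPochInf b)) :=
    (tendsto_qPoch hb).comp (Filter.tendsto_id.const_mul_atTop' hc)
  have hfin : ∀ N, (∏ k ∈ Finset.range N, ((1 - -q * (q ^ 2) ^ (2 * k)) *
      (1 - (q ^ 2) ^ (2 * k + 2) / -q))) * qPoch ((q ^ 2) ^ 2) (2 * N) * qPoch q (4 * N) =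
      qPoch (q ^ 2) (4 * N) * qPoch (q ^ 2) (2 * N) := by
    intro N
    induction N with
    | zero => simp [qPoch]
    | succ N ih =>
      have h2 (b : ℂ) : qPoch b (2 * (N + 1)) =
          qPoch b (2 * N) * ((1 - b * (b ^ N) ^ 2) * (1 - b ^ 2 * (b ^ N) ^ 2)) := by
        rw [show 2 * (N + 1) = 2 * N + 1 + 1 by ring, qPoch, Finset.prod_range_succ,
          Finset.prod_range_succ, ← qPoch]
        ring
      have h4 (b : ℂ) : qPoch b (4 * (N + 1)) =
          qPoch b (4 * N) * ((1 - b * (b ^ N) ^ 4) * (1 - b ^ 2 * (b ^ N) ^ 4) *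
            (1 - b ^ 3 * (b ^ N) ^ 4) * (1 - b ^ 4 * (b ^ N) ^ 4)) := by
        rw [show 4 * (N + 1) = 4 * N + 1 + 1 + 1 + 1 by ring, qPoch, Finset.prod_range_succ,
          Finset.prod_range_succ, Finset.prod_range_succ, Finset.prod_range_succ, ← qPoch]
        ring
      have : (1 - (q ^ 2) ^ (2 * N + 2) / -q) = 1 + q ^ 3 * (q ^ N) ^ 4 := by
        field_simp; ring
      rw [Finset.prod_range_succ, h2, h2, h4, h4, this]
      linear_combination (1 - q ^ 2 * (q ^ N) ^ 8) * (1 - q ^ 4 * (q ^ N) ^ 8) *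
        (1 - q ^ 6 * (q ^ N) ^ 8) * (1 - q ^ 8 * (q ^ N) ^ 8) * (1 - q ^ 2 * (q ^ N) ^ 4) *
        (1 - q ^ 4 * (q ^ N) ^ 4) * ih
  have h1 := (ht.mul (t hq4 two_pos)).mul (t hq four_pos)
  have h2 := (t hq2 four_pos).mul (t hq2 two_pos)
  have := tendsto_nhds_unique (h1.congr hfin) h2
  rwa [div_mul_cancel₀ _ (qPochInf_ne_zero hq4), ← sq] at this

/-- Euler's pentagonal number theorem (in the variable `q ^ 2`). -/
theorem tsum_pentagonal_sq {q : ℂ} (h0 : q ≠ 0) (hq : ‖q‖ < 1) :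
    ∑' k : ℤ, (-1) ^ k * q ^ (3 * k ^ 2 - k) = qPochInf (q ^ 2) := by
  have hq2 := norm_sq_lt_one hq
  have hq3 : ‖q ^ 3‖ < 1 := by
    rw [norm_pow]; exact pow_lt_one₀ (norm_nonneg _) hq three_ne_zero
  have hq6 : ‖(q ^ 3) ^ 2‖ < 1 := norm_sq_lt_one hq3
  have ht := tendsto_triple_product (pow_ne_zero 3 h0) hq3 (pow_ne_zero 2 h0)
  have hs : ∀ k : ℤ, (-1) ^ k * (q ^ 3) ^ (k ^ 2 - k) * (q ^ 2) ^ k =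
      (-1) ^ k * q ^ (3 * k ^ 2 - k) := by
    intro k
    rw [← zpow_natCast q 2, ← zpow_natCast q 3, ← zpow_mul, ← zpow_mul, mul_assoc, ← zpow_add₀ h0]
    push_cast
    ring_nf
  simp only [hs] at ht
  have hfin : ∀ N, (∏ k ∈ Finset.range N, ((1 - q ^ 2 * (q ^ 3) ^ (2 * k)) *
      (1 - (q ^ 3) ^ (2 * k + 2) / q ^ 2))) * qPoch ((q ^ 3) ^ 2) N = qPoch (q ^ 2) (3 * N) := by
    intro N
    induction N with
    | zero => simp [qPoch]
    | succ N ih =>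
      have h3 : qPoch (q ^ 2) (3 * (N + 1)) =
          qPoch (q ^ 2) (3 * N) * ((1 - q ^ 2 * (q ^ N) ^ 6) * (1 - q ^ 4 * (q ^ N) ^ 6) *
            (1 - q ^ 6 * (q ^ N) ^ 6)) := by
        rw [show 3 * (N + 1) = 3 * N + 1 + 1 + 1 by ring, qPoch, Finset.prod_range_succ,
          Finset.prod_range_succ, Finset.prod_range_succ, ← qPoch]
        ring
      have : (1 - (q ^ 3) ^ (2 * N + 2) / q ^ 2) = 1 - q ^ 4 * (q ^ N) ^ 6 := by
        field_simp; ring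
      rw [h3, ← ih, Finset.prod_range_succ, this, qPoch, qPoch, Finset.prod_range_succ]
      ring
  have h1 := ht.mul (tendsto_qPoch hq6)
  have h2 : Filter.Tendsto (fun N : ℕ => qPoch (q ^ 2) (3 * N)) Filter.atTop
      (nhds (qPochInf (q ^ 2))) :=
    (tendsto_qPoch hq2).comp (Filter.tendsto_id.const_mul_atTop' three_pos)
  have := tendsto_nhds_unique (h1.congr hfin) h2
  rwa [div_mul_cancel₀ _ (qPochInf_ne_zero hq6)] at this

lemma hasSum_triple_finite_deriv {q : ℂ} (h0 : q ≠ 0) (hq : ‖q‖ < 1) (N : ℕ) :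
    HasSum (fun k : ℤ => qPoch (q ^ 2) (2 * (N + 1)) * tripleCoeff q (N + 1) k * k)
      (-(qPoch (q ^ 2) N * qPoch (q ^ 2) (N + 1))) := by
  set g : ℂ → ℂ := fun x => (∏ k ∈ Finset.range N, (1 - x * q ^ (2 * (k + 1)))) *
    ∏ k ∈ Finset.range (N + 1), (1 - q ^ (2 * k + 2) / x)
  have hg : DifferentiableAt ℂ g 1 := by
    refine DifferentiableAt.mul ?_ ?_
    · refine DifferentiableAt.fun_finsetProd fun k _ => by fun_prop
    · refine DifferentiableAt.fun_finsetProd fun k _ => ?_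
      exact (differentiableAt_const _).sub
        ((differentiableAt_const _).div differentiableAt_id one_ne_zero)
  have hg1 : g 1 = qPoch (q ^ 2) N * qPoch (q ^ 2) (N + 1) := by
    simp only [g, qPoch, one_mul, div_one, ← pow_mul, mul_add, mul_one]
  have hd1 : HasDerivAt (fun x => (1 - x) * g x) (-g 1) 1 := by
    have := ((hasDerivAt_const (1 : ℂ) (1 : ℂ)).sub (hasDerivAt_id 1)).mul hg.hasDerivAt
    simpa using! this
  have hd2 : HasDerivAt (fun x => ∑ k ∈ Finset.Icc (-((N + 1 : ℕ) : ℤ)) (N + 1 : ℕ),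
      qPoch (q ^ 2) (2 * (N + 1)) * tripleCoeff q (N + 1) k * x ^ k)
      (∑ k ∈ Finset.Icc (-((N + 1 : ℕ) : ℤ)) (N + 1 : ℕ),
        qPoch (q ^ 2) (2 * (N + 1)) * tripleCoeff q (N + 1) k * k) 1 := by
    refine HasDerivAt.fun_sum fun k _ => ?_
    simpa using (hasDerivAt_zpow k (1 : ℂ) (Or.inl one_ne_zero)).const_mul
      (qPoch (q ^ 2) (2 * (N + 1)) * tripleCoeff q (N + 1) k)
  have he : (fun x => (1 - x) * g x) =ᶠ[nhds 1]
      (fun x => ∑ k ∈ Finset.Icc (-((N + 1 : ℕ) : ℤ)) (N + 1 : ℕ),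
        qPoch (q ^ 2) (2 * (N + 1)) * tripleCoeff q (N + 1) k * x ^ k) := by
    filter_upwards [isOpen_ne.mem_nhds (one_ne_zero (α := ℂ))] with x hx
    have h1 := hasSum_triple_finite h0 hq hx (N + 1)
    have h2 := hasSum_sum_of_ne_finset_zero (L := .unconditional ℤ) (s := Finset.Icc (-((N + 1 : ℕ) : ℤ)) (N + 1 : ℕ))
      (f := fun k => qPoch (q ^ 2) (2 * (N + 1)) * tripleCoeff q (N + 1) k * x ^ k)
      fun k hk => by rw [tripleCoeff_eq_zero hk]; simp
    rw [h2.unique h1, Finset.prod_mul_distrib, Finset.prod_range_succ']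
    simp [g]
    ring
  have hu := hd1.unique (hd2.congr_of_eventuallyEq he)
  rw [← hg1, hu]
  exact hasSum_sum_of_ne_finset_zero fun k hk => by rw [tripleCoeff_eq_zero hk]; simp

lemma norm_intCast_le_exp (k : ℤ) : ‖(k : ℂ)‖ ≤ ‖Complex.exp 1 ^ k‖ + ‖Complex.exp (-1) ^ k‖ := by
  have h : ‖(k : ℂ)‖ = |(k : ℝ)| := by
    rw [← Complex.ofReal_intCast, Complex.norm_real, Real.norm_eq_abs]
  rw [h, ← Complex.exp_int_mul, ← Complex.exp_int_mul, Complex.norm_exp, Complex.norm_exp]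
  have h1 := Real.add_one_le_exp (k : ℝ)
  have h2 := Real.add_one_le_exp (-(k : ℝ))
  have h3 := Real.exp_pos (k : ℝ)
  have h4 := Real.exp_pos (-(k : ℝ))
  simp only [mul_one, intCast_re, mul_neg, neg_re]
  rcases abs_cases (k : ℝ) with h | h <;> linarith

lemma summable_norm_intCast_mul_zpow_quadratic {q : ℂ} (h0 : q ≠ 0) (hq : ‖q‖ < 1) {α : ℤ}
    (hα : 0 < α) (β : ℤ) : Summable fun k : ℤ => ‖q ^ (α * k ^ 2 + β * k) * k‖ := by
  have h1 := summable_norm_zpow_quadratic h0 hq hα β (Complex.exp_ne_zero 1)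
  have h2 := summable_norm_zpow_quadratic h0 hq hα β (Complex.exp_ne_zero (-1))
  refine Summable.of_nonneg_of_le (fun _ => norm_nonneg _) (fun k => ?_) (h1.add h2)
  rw [norm_mul, norm_mul, norm_mul, ← mul_add]
  gcongr
  exact norm_intCast_le_exp k

/-- Jacobi's identity for the cube of the Euler product (in the variable `q ^ 2`). -/
theorem tsum_jacobi_cube {q : ℂ} (h0 : q ≠ 0) (hq : ‖q‖ < 1) :
    ∑' k : ℤ, (-1) ^ k * (k + 1) * q ^ (k ^ 2 + k) = qPochInf (q ^ 2) ^ 3 := by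
  have hq2 := norm_sq_lt_one hq
  obtain ⟨C, hC⟩ := exists_norm_qPochInv_le hq2
  have hC0 : 0 ≤ C := (norm_nonneg _).trans (hC 0)
  have key : Filter.Tendsto (fun N : ℕ => ∑' k : ℤ, tripleCoeff q N k * k) Filter.atTop
      (nhds (∑' k : ℤ, (-1) ^ k * q ^ (k ^ 2 - k) *
        ((qPochInf (q ^ 2))⁻¹ * (qPochInf (q ^ 2))⁻¹) * k)) := by
    refine tendsto_tsum_of_dominated_convergence
      ((summable_norm_intCast_mul_zpow_quadratic h0 hq one_pos (-1)).mul_left (C * C))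
      (fun k => ?_) ?_
    · refine Filter.Tendsto.mul_const _ (Filter.Tendsto.const_mul _ ?_)
      refine (tendsto_qPochInv_add hq2 k).mul ?_
      simpa [sub_eq_add_neg] using tendsto_qPochInv_add hq2 (-k)
    · filter_upwards with N k
      rw [tripleCoeff, norm_mul, norm_mul, norm_mul, norm_mul, norm_mul, norm_zpow (-1 : ℂ),
        norm_neg, norm_one, one_zpow, one_mul, mul_comm ‖q ^ _‖,
        show 1 * k ^ 2 + -1 * k = k ^ 2 - k by ring, mul_assoc]
      gcongr
      · exact hC _
      · exact hC _
  have h2 : Filter.Tendsto (fun N : ℕ => qPoch (q ^ 2) (2 * (N + 1))) Filter.atTop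
      (nhds (qPochInf (q ^ 2))) :=
    (tendsto_qPoch hq2).comp ((Filter.tendsto_add_atTop_nat 1).const_mul_atTop' two_pos)
  have h3 := h2.mul (key.comp (Filter.tendsto_add_atTop_nat 1))
  have h4 : Filter.Tendsto (fun N : ℕ => -(qPoch (q ^ 2) N * qPoch (q ^ 2) (N + 1))) Filter.atTop
      (nhds (-(qPochInf (q ^ 2) * qPochInf (q ^ 2)))) :=
    ((tendsto_qPoch hq2).mul ((tendsto_qPoch hq2).comp (Filter.tendsto_add_atTop_nat 1))).neg
  have h5 := tendsto_nhds_unique h4 (h3.congr fun N => by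
    rw [← (hasSum_triple_finite_deriv h0 hq N).tsum_eq, Function.comp_apply, ← tsum_mul_left]
    simp only [mul_assoc])
  have hne := qPochInf_ne_zero hq2
  have h6 : ∑' k : ℤ, (-1) ^ k * q ^ (k ^ 2 - k) *
      ((qPochInf (q ^ 2))⁻¹ * (qPochInf (q ^ 2))⁻¹) * k =
      -(∑' k : ℤ, (-1) ^ k * (k + 1) * q ^ (k ^ 2 + k)) *
        ((qPochInf (q ^ 2))⁻¹ * (qPochInf (q ^ 2))⁻¹) := by
    rw [← (Equiv.addRight (1 : ℤ)).tsum_eq, ← tsum_neg, ← tsum_mul_right]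
    refine tsum_congr fun k => ?_
    rw [Equiv.coe_addRight, zpow_add₀ (by norm_num), zpow_one,
      show (k + 1) ^ 2 - (k + 1) = k ^ 2 + k by ring]
    push_cast
    ring
  rw [h6] at h5
  field_simp at h5
  linear_combination h5

/-- The sign attached to the cone `{r, s ≥ 0} ∪ {r, s < 0}` in an indefinite theta series. -/
def coneSign (r s : ℤ) : ℤ := if 0 ≤ r ∧ 0 ≤ s then 1 else if r < 0 ∧ s < 0 then -1 else 0

lemma coneSign_succ (r n : ℤ) :
    coneSign r (n + 1 - r) = coneSign r (n - r) + if r = n + 1 then 1 else 0 := by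
  unfold coneSign
  split_ifs <;> omega

lemma hasSum_coneSign_mul_zpow {w : ℂ} (h0 : w ≠ 0) (h1 : w ≠ 1) (n : ℤ) :
    HasSum (fun r : ℤ => (coneSign r (n - r) : ℂ) * w ^ r) ((1 - w ^ (n + 1)) / (1 - w)) := by
  have h1' : 1 - w ≠ 0 := sub_ne_zero.mpr h1.symm
  have step (n r : ℤ) : (coneSign r (n + 1 - r) : ℂ) * w ^ r =
      coneSign r (n - r) * w ^ r + if r = n + 1 then w ^ (n + 1) else 0 := by
    rw [coneSign_succ]
    split_ifs with h
    · subst h; push_cast; ring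
    · simp
  induction n using Int.inductionOn' (b := -1) with
  | zero =>
    have : ∀ r : ℤ, coneSign r (-1 - r) = 0 := fun r => by unfold coneSign; split_ifs <;> omega
    simp [this, hasSum_zero]
  | succ n _ ih =>
    have := ih.add (hasSum_ite_eq (n + 1) (w ^ (n + 1)))
    simp only [← step] at this
    convert this using 1
    rw [zpow_add₀ h0 (n + 1)]
    field_simp
    ring
  | pred n _ ih =>
    have := ih.sub (hasSum_ite_eq n (w ^ n))
    have e (r : ℤ) := step (n - 1) r
    simp only [sub_add_cancel] at e
    simp only [e, add_sub_cancel_right] at this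
    rw [show (1 - w ^ (n - 1 + 1)) / (1 - w) = (1 - w ^ (n + 1)) / (1 - w) - w ^ n by
      rw [sub_add_cancel, zpow_add_one₀ h0]
      field_simp
      ring]
    exact this

lemma hasSum_coneSign (n : ℤ) :
    HasSum (fun r : ℤ => (coneSign r (n - r) : ℂ)) (n + 1) := by
  have step (n r : ℤ) : (coneSign r (n + 1 - r) : ℂ) =
      coneSign r (n - r) + if r = n + 1 then 1 else 0 := by
    rw [coneSign_succ]; push_cast; rfl
  induction n using Int.inductionOn' (b := -1) with
  | zero =>
    have : ∀ r : ℤ, coneSign r (-1 - r) = 0 := fun r => by unfold coneSign; split_ifs <;> omega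
    simp [this, hasSum_zero]
  | succ n _ ih =>
    have := ih.add (hasSum_ite_eq (n + 1) 1)
    simp only [← step] at this
    convert this using 1
    push_cast; ring
  | pred n _ ih =>
    have := ih.sub (hasSum_ite_eq n 1)
    have e (r : ℤ) := step (n - 1) r
    simp only [sub_add_cancel] at e
    simp only [e, add_sub_cancel_right] at this
    rw [show ((n - 1 : ℤ) : ℂ) + 1 = n + 1 - 1 by push_cast; ring]
    rw [add_sub_cancel_right]
    exact this

lemma neg_one_zpow_sub_eq (n m : ℤ) (h : Odd (n + m)) : (-1 : ℂ) ^ m = -(-1) ^ n := by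
  rcases Int.even_or_odd n with hn | hn
  · have hm : Odd m := by rw [Int.odd_add] at h; grind
    rw [hn.neg_one_zpow, hm.neg_one_zpow]
  · have hm : Even m := by rw [Int.odd_add] at h; grind
    rw [hn.neg_one_zpow, hm.neg_one_zpow, neg_neg]

/-- The odd theta series vanish at lattice points. -/
lemma tsum_alternating_zpow_eq_zero (q : ℂ) (b : ℤ) :
    ∑' n : ℤ, (-1) ^ n * q ^ (n ^ 2 + n - 2 * b * n) = 0 := by
  have h := (Equiv.subLeft (2 * b - 1)).tsum_eq
    fun n : ℤ => (-1 : ℂ) ^ n * q ^ (n ^ 2 + n - 2 * b * n)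
  have e (n : ℤ) : (-1 : ℂ) ^ (2 * b - 1 - n) *
      q ^ ((2 * b - 1 - n) ^ 2 + (2 * b - 1 - n) - 2 * b * (2 * b - 1 - n)) =
      -((-1) ^ n * q ^ (n ^ 2 + n - 2 * b * n)) := by
    rw [neg_one_zpow_sub_eq n (2 * b - 1 - n) ⟨b - 1, by ring⟩]
    ring_nf
  simp only [Equiv.subLeft_apply, e, tsum_neg] at h
  linear_combination (-1 / 2) * h

lemma summable_alternating_zpow {q : ℂ} (h0 : q ≠ 0) (hq : ‖q‖ < 1) (b : ℤ) :
    Summable fun n : ℤ => (-1) ^ n * q ^ (n ^ 2 + n - 2 * b * n) := by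
  refine Summable.of_norm ?_
  refine (summable_norm_zpow_quadratic h0 hq one_pos (1 - 2 * b) one_ne_zero).congr fun n => ?_
  rw [norm_mul, norm_mul, norm_zpow (-1 : ℂ)]
  simp
  ring_nf

lemma tsum_alternating_succ_mul {q : ℂ} (h0 : q ≠ 0) (hq : ‖q‖ < 1) (a : ℤ) :
    ∑' n : ℤ, (-1) ^ n * q ^ (n ^ 2 + n - 2 * a * n) * (n + 1) =
      (-1) ^ a * q ^ (a - a ^ 2) * qPochInf (q ^ 2) ^ 3 := by
  rw [← tsum_jacobi_cube h0 hq, ← (Equiv.addRight a).tsum_eq]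
  have e (m : ℤ) : (-1 : ℂ) ^ (m + a) * q ^ ((m + a) ^ 2 + (m + a) - 2 * a * (m + a)) *
      (((m + a : ℤ) : ℂ) + 1) =
      (-1) ^ a * q ^ (a - a ^ 2) * ((-1) ^ m * (m + 1) * q ^ (m ^ 2 + m)) +
      (-1) ^ a * q ^ (a - a ^ 2) * a * ((-1) ^ m * q ^ (m ^ 2 + m - 2 * 0 * m)) := by
    rw [zpow_add₀ (by norm_num), show (m + a) ^ 2 + (m + a) - 2 * a * (m + a) =
      (a - a ^ 2) + (m ^ 2 + m) by ring, zpow_add₀ h0]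
    push_cast
    ring_nf
  simp only [Equiv.coe_addRight, e]
  rw [Summable.tsum_add, tsum_mul_left, tsum_mul_left, tsum_alternating_zpow_eq_zero, mul_zero,
    add_zero]
  · refine Summable.mul_left _ (Summable.of_norm ?_)
    refine ((summable_norm_intCast_mul_zpow_quadratic h0 hq one_pos 1).add
      (summable_norm_zpow_quadratic h0 hq one_pos 1 one_ne_zero)).of_nonneg_of_le
      (fun _ => norm_nonneg _) fun m => ?_
    rw [one_zpow, mul_one, one_mul, one_mul, mul_assoc, norm_mul, norm_zpow (-1 : ℂ), norm_neg,
      norm_one, one_zpow, one_mul, add_mul, one_mul, mul_comm (m : ℂ)]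
    exact norm_add_le _ _
  · exact (summable_alternating_zpow h0 hq 0).mul_left _

/-- The sum of `q ^ (2 r s)` over the signed cone against shifted theta coefficients. -/
lemma tsum_cone {q : ℂ} (h0 : q ≠ 0) (hq : ‖q‖ < 1) (a b : ℤ)
    (hs : Summable fun x : ℤ × ℤ => (coneSign x.1 x.2 : ℂ) * (-1) ^ (x.1 + x.2) *
      q ^ ((x.1 + x.2) ^ 2 + (x.1 + x.2) - 2 * a * x.1 - 2 * b * x.2)) :
    ∑' x : ℤ × ℤ, (coneSign x.1 x.2 : ℂ) * (-1) ^ (x.1 + x.2) *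
      q ^ ((x.1 + x.2) ^ 2 + (x.1 + x.2) - 2 * a * x.1 - 2 * b * x.2) =
      if a = b then (-1) ^ a * q ^ (a - a ^ 2) * qPochInf (q ^ 2) ^ 3 else 0 := by
  let e : ℤ × ℤ ≃ ℤ × ℤ :=
    ⟨fun x => (x.2, x.1 - x.2), fun x => (x.1 + x.2, x.1), fun x => by simp, fun x => by simp⟩
  have hterm (n r : ℤ) : (coneSign r (n - r) : ℂ) * (-1) ^ (r + (n - r)) *
      q ^ ((r + (n - r)) ^ 2 + (r + (n - r)) - 2 * a * r - 2 * b * (n - r)) =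
      (-1) ^ n * q ^ (n ^ 2 + n - 2 * b * n) * (coneSign r (n - r) * (q ^ (2 * (b - a))) ^ r) := by
    rw [← zpow_mul, show (r + (n - r)) ^ 2 + (r + (n - r)) - 2 * a * r - 2 * b * (n - r) =
      (n ^ 2 + n - 2 * b * n) + 2 * (b - a) * r by ring, zpow_add₀ h0, add_sub_cancel]
    ring
  rw [← e.tsum_eq]
  rw [← e.summable_iff] at hs
  refine hs.tsum_prod.trans ?_
  simp only [Function.comp_apply, Equiv.coe_fn_mk, e, hterm, tsum_mul_left]
  split_ifs with h
  · subst h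
    simp only [sub_self, mul_zero, zpow_zero, one_zpow, mul_one, (hasSum_coneSign _).tsum_eq]
    exact tsum_alternating_succ_mul h0 hq a
  · have hw0 : q ^ (2 * (b - a)) ≠ 0 := zpow_ne_zero _ h0
    have hw1 : q ^ (2 * (b - a)) ≠ 1 := by
      intro h'
      have h2 := congrArg norm h'
      rw [norm_zpow, norm_one, zpow_eq_one_iff_right₀ (norm_nonneg _) hq.ne] at h2
      omega
    simp only [(hasSum_coneSign_mul_zpow hw0 hw1 _).tsum_eq]
    have e2 (n : ℤ) : (-1) ^ n * q ^ (n ^ 2 + n - 2 * b * n) *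
        ((1 - (q ^ (2 * (b - a))) ^ (n + 1)) / (1 - q ^ (2 * (b - a)))) =
        (1 - q ^ (2 * (b - a)))⁻¹ * ((-1) ^ n * q ^ (n ^ 2 + n - 2 * b * n)) -
        (1 - q ^ (2 * (b - a)))⁻¹ * q ^ (2 * (b - a)) *
          ((-1) ^ n * q ^ (n ^ 2 + n - 2 * a * n)) := by
      rw [zpow_add₀ hw0, zpow_one, ← zpow_mul, show n ^ 2 + n - 2 * a * n =
        (n ^ 2 + n - 2 * b * n) + 2 * (b - a) * n by ring, zpow_add₀ h0]
      ring
    simp only [e2]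
    rw [Summable.tsum_sub ((summable_alternating_zpow h0 hq b).mul_left _)
      ((summable_alternating_zpow h0 hq a).mul_left _), tsum_mul_left, tsum_mul_left,
      tsum_alternating_zpow_eq_zero, tsum_alternating_zpow_eq_zero]
    simp

lemma tsum_theta_convolution {p : ℂ} (h0 : p ≠ 0) (r : ℤ) :
    ∑' i : ℤ, (p ^ 2) ^ (i ^ 2 + i + (r - i) ^ 2) =
      p ^ (r ^ 2 + r) * ∑' i : ℤ, (p ^ 2) ^ (2 * i ^ 2 - i) := by
  have h (n : ℤ) : (p ^ 2) ^ n = p ^ (2 * n) := by rw [← zpow_natCast, ← zpow_mul]; rfl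
  simp only [h]
  rw [← tsum_mul_left]
  obtain ⟨t, rfl | rfl⟩ := r.even_or_odd'
  · rw [← (Equiv.subLeft t).tsum_eq]
    refine tsum_congr fun j => ?_
    rw [Equiv.subLeft_apply, ← zpow_add₀ h0]
    congr 1; ring
  · rw [← (Equiv.addRight t).tsum_eq]
    refine tsum_congr fun j => ?_
    rw [Equiv.coe_addRight, ← zpow_add₀ h0]
    congr 1; ring

lemma summable_theta_convolution {q : ℂ} (h0 : q ≠ 0) (hq : ‖q‖ < 1) :
    Summable fun x : ℤ × ℤ => ‖q ^ (x.2 ^ 2 + x.2 + (x.1 - x.2) ^ 2)‖ := by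
  let e : ℤ × ℤ ≃ ℤ × ℤ :=
    ⟨fun x => (x.1 + x.2, x.2), fun x => (x.1 - x.2, x.2), fun x => by simp, fun x => by simp⟩
  rw [← e.summable_iff]
  have h1 := summable_norm_zpow_quadratic h0 hq one_pos 0 one_ne_zero
  have h2 := summable_norm_zpow_quadratic h0 hq one_pos 1 one_ne_zero
  refine (h1.mul_of_nonneg h2 (fun _ => norm_nonneg _) fun _ => norm_nonneg _).congr fun x => ?_
  simp only [Function.comp_apply, e, Equiv.coe_fn_mk, ← norm_mul, one_zpow, mul_one,
    ← zpow_add₀ h0]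
  congr 2; ring

/-- The term of the fourfold sum linking the indefinite theta series to Gauss' series. -/
noncomputable def fourfoldTerm (q : ℂ) (x y : ℤ × ℤ) : ℂ :=
  (coneSign x.1 x.2 : ℂ) * (-1) ^ (x.1 + x.2) * q ^ (2 * x.1 * x.2 +
    (y.1 ^ 2 + y.1 + (x.1 - y.1) ^ 2) + (y.2 ^ 2 + y.2 + (x.2 - y.2) ^ 2))

lemma summable_fourfoldTerm {q : ℂ} (h0 : q ≠ 0) (hq : ‖q‖ < 1) :
    Summable fun z : (ℤ × ℤ) × (ℤ × ℤ) => fourfoldTerm q z.1 z.2 := by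
  have h := summable_theta_convolution h0 hq
  have h2 := (h.mul_of_nonneg h (fun _ => norm_nonneg _) fun _ => norm_nonneg _)
  rw [← (Equiv.prodProdProdComm ℤ ℤ ℤ ℤ).summable_iff] at h2
  refine Summable.of_norm (h2.of_nonneg_of_le (fun _ => norm_nonneg _) fun z => ?_)
  obtain ⟨⟨r, s⟩, ⟨i, j⟩⟩ := z
  simp only [Function.comp_apply, Equiv.prodProdProdComm_apply, fourfoldTerm]
  rw [add_assoc, zpow_add₀ h0, zpow_add₀ h0, norm_mul, norm_mul, norm_mul, norm_mul,
    norm_zpow (-1 : ℂ), norm_neg, norm_one, one_zpow, mul_one, ← mul_assoc]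
  refine mul_le_of_le_one_left (by positivity) ?_
  unfold coneSign
  split_ifs with h1 h2
  · rw [norm_zpow, Int.cast_one, norm_one, one_mul]
    exact zpow_le_one₀ (norm_pos_iff.mpr h0) hq.le (by nlinarith [mul_nonneg h1.1 h1.2])
  · rw [norm_zpow, Int.cast_neg, Int.cast_one, norm_neg, norm_one, one_mul]
    exact zpow_le_one₀ (norm_pos_iff.mpr h0) hq.le (by nlinarith [mul_pos_of_neg_of_neg h2.1 h2.2])
  · simp

/-- The Hecke–Rogers identity for the square of the Euler product, in the variable `p ^ 2`. -/
theorem tsum_cone_eq_qPochInf_sq {p : ℂ} (h0 : p ≠ 0) (hp : ‖p‖ < 1) :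
    ∑' x : ℤ × ℤ, (coneSign x.1 x.2 : ℂ) * (-1) ^ (x.1 + x.2) *
      p ^ (x.1 ^ 2 + x.1 + x.2 ^ 2 + x.2 + 4 * x.1 * x.2) = qPochInf (p ^ 2) ^ 2 := by
  set F := ∑' x : ℤ × ℤ, (coneSign x.1 x.2 : ℂ) * (-1) ^ (x.1 + x.2) *
      p ^ (x.1 ^ 2 + x.1 + x.2 ^ 2 + x.2 + 4 * x.1 * x.2) with hF
  have hq0 := pow_ne_zero 2 h0
  have hq := norm_sq_lt_one hp
  obtain ⟨q, hqd⟩ : ∃ q, q = p ^ 2 := ⟨_, rfl⟩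
  rw [← hqd] at hq0 hq ⊢
  set ψ := ∑' i : ℤ, q ^ (2 * i ^ 2 - i) with hψ
  have hsum := summable_fourfoldTerm hq0 hq
  have hrow (r : ℤ) : Summable fun i : ℤ => ‖q ^ (i ^ 2 + i + (r - i) ^ 2)‖ :=
    (summable_theta_convolution hq0 hq).prod_factor r
  have hA : ∑' z : (ℤ × ℤ) × (ℤ × ℤ), fourfoldTerm q z.1 z.2 = F * ψ ^ 2 := by
    rw [hsum.tsum_prod, hF, ← tsum_mul_right]
    refine tsum_congr fun x => ?_
    have e (y : ℤ × ℤ) : fourfoldTerm q x y = (coneSign x.1 x.2 : ℂ) * (-1) ^ (x.1 + x.2) *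
        q ^ (2 * x.1 * x.2) * (q ^ (y.1 ^ 2 + y.1 + (x.1 - y.1) ^ 2) *
          q ^ (y.2 ^ 2 + y.2 + (x.2 - y.2) ^ 2)) := by
      rw [fourfoldTerm, zpow_add₀ hq0, zpow_add₀ hq0]; ring
    simp only [e, tsum_mul_left]
    rw [← tsum_mul_tsum_of_summable_norm (hrow x.1) (hrow x.2), hqd,
      tsum_theta_convolution h0, tsum_theta_convolution h0, ← hqd, ← hψ]
    have : q ^ (2 * x.1 * x.2) = p ^ (4 * x.1 * x.2) := by
      rw [hqd, ← zpow_natCast, ← zpow_mul]; congr 1; push_cast; ring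
    have hp2 : p ^ (x.1 ^ 2 + x.1 + x.2 ^ 2 + x.2 + 4 * x.1 * x.2) =
        p ^ (4 * x.1 * x.2) * (p ^ (x.1 ^ 2 + x.1) * p ^ (x.2 ^ 2 + x.2)) := by
      rw [← zpow_add₀ h0, ← zpow_add₀ h0]
      congr 1; ring
    rw [this, hp2]
    ring
  have hB : ∑' z : (ℤ × ℤ) × (ℤ × ℤ), fourfoldTerm q z.1 z.2 = qPochInf (q ^ 2) ^ 4 := by
    let e : (ℤ × ℤ) × (ℤ × ℤ) ≃ (ℤ × ℤ) × (ℤ × ℤ) :=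
      ⟨fun z => (z.2, z.2 - z.1), fun z => (z.1 - z.2, z.1), fun z => by simp, fun z => by simp⟩
    rw [← e.tsum_eq]
    rw [← e.summable_iff] at hsum
    have hterm (a b : ℤ) (x : ℤ × ℤ) : fourfoldTerm q x (x - (a, b)) =
        q ^ (2 * a ^ 2 - a + (2 * b ^ 2 - b)) * ((coneSign x.1 x.2 : ℂ) * (-1) ^ (x.1 + x.2) *
          q ^ ((x.1 + x.2) ^ 2 + (x.1 + x.2) - 2 * a * x.1 - 2 * b * x.2)) := by
      rw [fourfoldTerm, mul_left_comm, ← zpow_add₀ hq0]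
      simp only [Prod.fst_sub, Prod.snd_sub]
      congr 2; ring
    have hin (a b : ℤ) : ∑' x : ℤ × ℤ, fourfoldTerm q x (x - (a, b)) =
        if b = a then (-1) ^ a * q ^ (3 * a ^ 2 - a) * qPochInf (q ^ 2) ^ 3 else 0 := by
      have hs := hsum.prod_factor (a, b)
      simp only [Function.comp_apply, e, Equiv.coe_fn_mk, hterm] at hs
      rw [summable_mul_left_iff (zpow_ne_zero _ hq0)] at hs
      simp only [hterm, tsum_mul_left]
      rw [tsum_cone hq0 hq a b hs]
      split_ifs with h h' h'
      · subst h
        rw [show 3 * a ^ 2 - a = 2 * a ^ 2 - a + (2 * a ^ 2 - a) + (a - a ^ 2) by ring,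
          zpow_add₀ hq0 _ (a - a ^ 2)]
        ring
      · exact absurd h.symm h'
      · exact absurd h'.symm h
      · simp
    have hs2 := hsum.prod
    refine hsum.tsum_prod.trans ?_
    simp only [Function.comp_apply, e, Equiv.coe_fn_mk] at hs2 ⊢
    rw [hs2.tsum_prod]
    simp only [hin, tsum_ite_eq]
    rw [tsum_mul_right, tsum_pentagonal_sq hq0 hq]
    ring
  have hG := tsum_gauss hq0 hq
  rw [← hψ] at hG
  have hne := qPochInf_ne_zero (norm_sq_lt_one hq)
  have hψ0 : ψ ≠ 0 := by
    rintro h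
    rw [h, zero_mul] at hG
    exact pow_ne_zero 2 hne hG.symm
  have : F * ψ ^ 2 = qPochInf q ^ 2 * ψ ^ 2 := by
    rw [← hA, hB]
    linear_combination -(qPochInf (q ^ 2) ^ 2 + ψ * qPochInf q) * hG
  exact mul_right_cancel₀ (pow_ne_zero 2 hψ0) this

lemma ratio_cond_iff (x y : ℝ) :
    (0 < x + y * √3 ∧ 2 - √3 < |(x + y * √3) / (x - y * √3)| ∧
      |(x + y * √3) / (x - y * √3)| ≤ 2 + √3) ↔
    (0 < x ∧ -x < 3 * y ∧ 3 * y ≤ x) ∨ (0 < y ∧ -y < x ∧ x ≤ y) := by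
  have hs : √3 * √3 = 3 := Real.mul_self_sqrt (by norm_num)
  have hs0 : 0 ≤ √3 := Real.sqrt_nonneg 3
  generalize √3 = s at hs hs0 ⊢
  have hs1 : 1 < s := by nlinarith
  have hs2 : s < 2 := by nlinarith
  have hy : y * s * s = 3 * y := by rw [mul_assoc, hs, mul_comm]
  rcases lt_trichotomy (x - y * s) 0 with hM | hM | hM
  · have hlow : (2 - s) * -(x - y * s) < x + y * s ↔ 0 < (3 - s) * (x + y) := by
      constructor <;> intro h <;> linarith
    have hupp : x + y * s ≤ (2 + s) * -(x - y * s) ↔ 0 ≤ (3 + s) * (y - x) := by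
      constructor <;> intro h <;> linarith
    rw [mul_pos_iff_of_pos_left (by linarith)] at hlow
    rw [mul_nonneg_iff_of_pos_left (by linarith)] at hupp
    constructor
    · rintro ⟨h0, h1, h2⟩
      rw [abs_div, abs_of_pos h0, abs_of_neg hM] at h1 h2
      rw [lt_div_iff₀ (by linarith), hlow] at h1
      rw [div_le_iff₀ (by linarith), hupp] at h2
      exact Or.inr ⟨by linarith, by linarith, by linarith⟩
    · rintro (⟨h0, h1, h2⟩ | ⟨h0, h1, h2⟩)
      · nlinarith
      · have hL : 0 < x + y * s := by nlinarith
        rw [abs_div, abs_of_pos hL, abs_of_neg hM, lt_div_iff₀ (by linarith), hlow,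
          div_le_iff₀ (by linarith), hupp]
        exact ⟨hL, by linarith, by linarith⟩
  · rw [hM, div_zero, abs_zero]
    constructor
    · rintro ⟨-, h1, -⟩; linarith
    · rintro (⟨h0, h1, h2⟩ | ⟨h0, h1, h2⟩) <;> nlinarith
  · have hlow : (2 - s) * (x - y * s) < x + y * s ↔ 0 < (s - 1) * (x + 3 * y) := by
      constructor <;> intro h <;> linarith
    have hupp : x + y * s ≤ (2 + s) * (x - y * s) ↔ 0 ≤ (1 + s) * (x - 3 * y) := by
      constructor <;> intro h <;> linarith
    rw [mul_pos_iff_of_pos_left (by linarith)] at hlow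
    rw [mul_nonneg_iff_of_pos_left (by linarith)] at hupp
    constructor
    · rintro ⟨h0, h1, h2⟩
      rw [abs_div, abs_of_pos h0, abs_of_pos hM] at h1 h2
      rw [lt_div_iff₀ hM, hlow] at h1
      rw [div_le_iff₀ hM, hupp] at h2
      exact Or.inl ⟨by linarith, by linarith, by linarith⟩
    · rintro (⟨h0, h1, h2⟩ | ⟨h0, h1, h2⟩)
      · have hL : 0 < x + y * s := by nlinarith
        rw [abs_div, abs_of_pos hL, abs_of_pos hM, lt_div_iff₀ hM, hlow, div_le_iff₀ hM, hupp]
        exact ⟨hL, by linarith, by linarith⟩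
      · nlinarith

lemma zsqrt3_ratio_cond_iff (l : ℤ√3) :
    (0 < zsqrt3ToReal l ∧ 2 - √3 < |zsqrt3ToReal l / zsqrt3ToReal (star l)| ∧
      |zsqrt3ToReal l / zsqrt3ToReal (star l)| ≤ 2 + √3) ↔
    (0 < l.re ∧ -l.re < 3 * l.im ∧ 3 * l.im ≤ l.re) ∨
      (0 < l.im ∧ -l.im < l.re ∧ l.re ≤ l.im) := by
  have h := ratio_cond_iff l.re l.im
  have hstar : zsqrt3ToReal (star l) = l.re - l.im * √3 := by
    simp [zsqrt3ToReal, sub_eq_add_neg]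
  rw [hstar, zsqrt3ToReal, h]
  norm_cast

lemma two_sqrt3_dvd_iff (l : ℤ√3) : (⟨0, 2⟩ : ℤ√3) ∣ l ↔ 6 ∣ l.re ∧ 2 ∣ l.im := by
  constructor
  · rintro ⟨c, rfl⟩
    simp only [Zsqrtd.re_mul, Zsqrtd.im_mul]
    omega
  · rintro ⟨⟨a, ha⟩, ⟨b, hb⟩⟩
    refine ⟨⟨b, a⟩, ?_⟩
    ext
    · simp only [Zsqrtd.re_mul]; omega
    · simp only [Zsqrtd.im_mul]; omega

lemma phi0_eq (l : ℤ√3) : phi0 l =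
    if (6 ∣ l.re - 1 ∧ 2 ∣ l.im) ∨ (6 ∣ l.re - 2 ∧ 2 ∣ l.im - 1) then 1
    else if (6 ∣ l.re - 5 ∧ 2 ∣ l.im) ∨ (6 ∣ l.re - 4 ∧ 2 ∣ l.im - 1) then -1 else 0 := by
  have h5 : (5 : ℤ√3) = ⟨5, 0⟩ := rfl
  unfold phi0
  simp only [two_sqrt3_dvd_iff, h5, Zsqrtd.re_sub, Zsqrtd.im_sub, Zsqrtd.re_one, Zsqrtd.im_one,
    sub_zero]

lemma norm_phi0_le_one (l : ℤ√3) : ‖(phi0 l : ℂ)‖ ≤ 1 := by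
  rw [phi0_eq]
  split_ifs <;> simp

/-- The term of the Hecke theta series, without the restriction to the fundamental domain. -/
noncomputable def heckeTerm (τ : ℂ) (l : ℤ√3) : ℂ :=
  (phi0 l : ℂ) * Complex.exp (2 * Real.pi * Complex.I * (|Zsqrtd.norm l| : ℤ) * τ / 12)

/-- Elements of `ℤ√3` as pairs of integers. -/
def zsqrt3EquivProd : ℤ√3 ≃ ℤ × ℤ where
  toFun l := (l.re, l.im)
  invFun x := ⟨x.1, x.2⟩
  left_inv _ := rfl
  right_inv _ := rfl

lemma summable_heckeTerm_of_norm {τ : ℂ} (hτ : 0 < τ.im) (D : ℤ√3 → Prop) [DecidablePred D]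
    (hD : ∀ l, D l → l.re ^ 2 + l.im ^ 2 ≤ 3 * |l.norm|) :
    Summable fun l : ℤ√3 => if D l then heckeTerm τ l else 0 := by
  set c := π * τ.im / 18 with hc
  have hc0 : 0 < c := by positivity
  have h := summable_exp_neg_sq_add hc0 0
  have h2 := h.mul_of_nonneg h (fun _ => (Real.exp_pos _).le) fun _ => (Real.exp_pos _).le
  rw [← zsqrt3EquivProd.summable_iff] at h2
  refine Summable.of_norm (h2.of_nonneg_of_le (fun _ => norm_nonneg _) fun l => ?_)
  simp only [Function.comp_apply, zsqrt3EquivProd, Equiv.coe_fn_mk]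
  split_ifs with hl
  · have hl' : (l.re ^ 2 + l.im ^ 2 : ℝ) ≤ 3 * (|l.norm| : ℤ) := by exact_mod_cast hD l hl
    rw [heckeTerm, norm_mul, ← Real.exp_add, Complex.norm_exp]
    refine (mul_le_of_le_one_left (Real.exp_pos _).le (norm_phi0_le_one l)).trans ?_
    rw [Real.exp_le_exp]
    generalize |l.norm| = N at hl' ⊢
    have : (2 * π * I * N * τ / 12 : ℂ).re = -(c * (3 * N)) := by
      rw [show (2 * π * I * N * τ / 12 : ℂ) =
        ((2 * π * N / 12 : ℝ) : ℂ) * (I * τ) by push_cast; ring, Complex.re_ofReal_mul]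
      simp only [Complex.mul_re, I_re, I_im]
      rw [hc]; ring
    rw [this]
    nlinarith [mul_le_mul_of_nonneg_left hl' hc0.le]
  · rw [norm_zero]; positivity

lemma phi0_neg_star (l : ℤ√3) : phi0 (-star l) = -phi0 l := by
  rw [phi0_eq, phi0_eq]
  simp only [Zsqrtd.re_neg, Zsqrtd.im_neg, Zsqrtd.re_star, Zsqrtd.im_star]
  split_ifs <;> omega

/-- The elements of negative norm do not contribute: `λ ↦ -λ'` changes the sign of the terms. -/
lemma tsum_heckeTerm_neg_norm (τ : ℂ) :
    ∑' l : ℤ√3, (if 0 < l.im ∧ -l.im < l.re ∧ l.re ≤ l.im then heckeTerm τ l else 0) = 0 := by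
  let e : ℤ√3 ≃ ℤ√3 := ⟨fun l => -star l, fun l => -star l, fun l => by simp, fun l => by simp⟩
  have h := e.tsum_eq fun l : ℤ√3 =>
    if 0 < l.im ∧ -l.im < l.re ∧ l.re ≤ l.im then heckeTerm τ l else 0
  have he (l : ℤ√3) : (if 0 < (e l).im ∧ -(e l).im < (e l).re ∧ (e l).re ≤ (e l).im then
      heckeTerm τ (e l) else 0) =
      -(if 0 < l.im ∧ -l.im < l.re ∧ l.re ≤ l.im then heckeTerm τ l else 0) := by
    have ht : heckeTerm τ (e l) = -heckeTerm τ l := by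
      simp only [heckeTerm, e, Equiv.coe_fn_mk, phi0_neg_star, Zsqrtd.norm_neg, Zsqrtd.norm_conj]
      push_cast; ring
    have hb (hl : l.re = l.im ∨ l.re = -l.im) : heckeTerm τ l = 0 := by
      have : phi0 l = 0 := by rw [phi0_eq]; split_ifs <;> omega
      rw [heckeTerm, this, Int.cast_zero, zero_mul]
    rw [ht]
    simp only [e, Equiv.coe_fn_mk, Zsqrtd.re_neg, Zsqrtd.im_neg, Zsqrtd.re_star, Zsqrtd.im_star,
      neg_neg]
    split_ifs with h1 h2 h2
    · rfl
    · rw [hb (by omega)]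
    · rw [hb (by omega)]
      simp
    · simp
  simp only [he, tsum_neg] at h
  linear_combination (-1 / 2) * h

/-- Parametrization of the elements of positive norm on which `phi0` does not vanish. -/
def conePoint (x : ℤ × ℤ) : ℤ√3 := ⟨|3 * (x.1 + x.2) + 1|, x.1 - x.2⟩

lemma conePoint_injective : Function.Injective conePoint := by
  rintro ⟨r, s⟩ ⟨r', s'⟩ h
  rw [conePoint, conePoint, Zsqrtd.mk.injEq] at h
  ext <;> grind

lemma phi0_conePoint (r s : ℤ) :
    (if 0 < (conePoint (r, s)).re ∧ -(conePoint (r, s)).re < 3 * (conePoint (r, s)).im ∧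
      3 * (conePoint (r, s)).im ≤ (conePoint (r, s)).re then phi0 (conePoint (r, s)) else 0) =
      coneSign r s * if 2 ∣ r + s then 1 else -1 := by
  rw [phi0_eq]
  simp only [conePoint]
  unfold coneSign
  rcases abs_cases (3 * (r + s) + 1) with ⟨h, h'⟩ | ⟨h, h'⟩ <;> simp only [h] <;>
    split_ifs <;> omega

lemma mem_range_conePoint {l : ℤ√3} (hl : 0 < l.re) (h : phi0 l ≠ 0) :
    l ∈ Set.range conePoint := by
  have h2 : (l.re % 3 = 1 ∨ l.re % 3 = 2) ∧ (l.re + l.im) % 2 = 1 := by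
    rw [phi0_eq] at h
    split_ifs at h <;> omega
  obtain ⟨h3 | h3, h4⟩ := h2
  · refine ⟨((l.re / 3 + l.im) / 2, (l.re / 3 - l.im) / 2), ?_⟩
    ext <;> simp only [conePoint]
    · rw [abs_of_nonneg] <;> omega
    · omega
  · refine ⟨((-((l.re + 1) / 3) + l.im) / 2, (-((l.re + 1) / 3) - l.im) / 2), ?_⟩
    ext <;> simp only [conePoint]
    · rw [abs_of_nonpos] <;> omega
    · omega

lemma heckeTerm_conePoint (τ : ℂ) (r s : ℤ) :
    (if 0 < (conePoint (r, s)).re ∧ -(conePoint (r, s)).re < 3 * (conePoint (r, s)).im ∧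
      3 * (conePoint (r, s)).im ≤ (conePoint (r, s)).re then heckeTerm τ (conePoint (r, s))
        else 0) = Complex.exp (2 * π * I * τ / 12) * ((coneSign r s : ℂ) * (-1) ^ (r + s) *
          Complex.exp (π * I * τ) ^ (r ^ 2 + r + s ^ 2 + s + 4 * r * s)) := by
  have h := phi0_conePoint r s
  have hsign : ((if 2 ∣ r + s then 1 else -1 : ℤ) : ℂ) = (-1) ^ (r + s) := by
    split_ifs with h
    · rw [(even_iff_two_dvd.mpr h).neg_one_zpow, Int.cast_one]
    · rw [(Int.not_even_iff_odd.mp fun h' => h h'.two_dvd).neg_one_zpow]; simp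
  by_cases hc : 0 < (conePoint (r, s)).re ∧ -(conePoint (r, s)).re < 3 * (conePoint (r, s)).im ∧
      3 * (conePoint (r, s)).im ≤ (conePoint (r, s)).re
  · rw [if_pos hc] at h ⊢
    have hN : |(conePoint (r, s)).norm| = 6 * (r ^ 2 + r + s ^ 2 + s + 4 * r * s) + 1 := by
      have hn : (conePoint (r, s)).norm = 6 * (r ^ 2 + r + s ^ 2 + s + 4 * r * s) + 1 := by
        simp only [Zsqrtd.norm_def, conePoint, abs_mul_abs_self]; ring
      rw [abs_of_nonneg, hn]
      rw [Zsqrtd.norm_def]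
      nlinarith
    rw [heckeTerm, h, hN, Int.cast_mul, hsign, ← Complex.exp_int_mul, mul_left_comm,
      ← Complex.exp_add]
    congr 2
    push_cast; ring
  · rw [if_neg hc] at h ⊢
    rw [← hsign, ← Int.cast_mul, ← h]
    simp

lemma dedekindEta_sq (τ : ℂ) : dedekindEta τ ^ 2 =
    Complex.exp (2 * π * I * τ / 12) * qPochInf (Complex.exp (π * I * τ) ^ 2) ^ 2 := by
  rw [dedekindEta, mul_pow, qPochInf, ← Complex.exp_nat_mul]
  congr 1
  · congr 1; push_cast; ring
  · congr 1
    refine tprod_congr fun n => ?_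
    rw [← pow_mul, ← Complex.exp_nat_mul]
    congr 2; push_cast; ring

lemma tsum_heckeTerm_pos_norm {τ : ℂ} (hτ : 0 < τ.im) :
    ∑' l : ℤ√3, (if 0 < l.re ∧ -l.re < 3 * l.im ∧ 3 * l.im ≤ l.re then heckeTerm τ l else 0) =
      dedekindEta τ ^ 2 := by
  have hp : ‖Complex.exp (π * I * τ)‖ < 1 := by
    rw [Complex.norm_exp, Real.exp_lt_one_iff]
    simp [Complex.mul_re, Complex.mul_im]
    positivity
  rw [dedekindEta_sq, ← tsum_cone_eq_qPochInf_sq (Complex.exp_ne_zero _) hp, ← tsum_mul_left,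
    ← conePoint_injective.tsum_eq]
  · exact tsum_congr fun x => heckeTerm_conePoint τ x.1 x.2
  · intro l hl
    rw [Function.mem_support, ne_eq, ite_eq_right_iff, Classical.not_imp] at hl
    refine mem_range_conePoint hl.1.1 fun h => hl.2 ?_
    rw [heckeTerm, h, Int.cast_zero, zero_mul]

/-- The Hecke theta series of the odd ray class character `φ` of `ℚ(√12)` equals `η²`:
`Σ_{λ ∈ ℤ[√3], λ > 0, 2−√3 < |λ/λ'| ≤ 2+√3} φ₀(λ) e^{2πi|Nm(λ)|τ/12} = η(τ)²`,
the series converging absolutely. -/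
theorem hecke_theta_eq_eta_sq (τ : ℂ) (hτ : 0 < τ.im) :
    Summable (fun l : ℤ√3 =>
      if 0 < zsqrt3ToReal l ∧
          2 - Real.sqrt 3 < |zsqrt3ToReal l / zsqrt3ToReal (star l)| ∧
          |zsqrt3ToReal l / zsqrt3ToReal (star l)| ≤ 2 + Real.sqrt 3 then
        (phi0 l : ℂ) *
          Complex.exp (2 * Real.pi * Complex.I * (|Zsqrtd.norm l| : ℤ) * τ / 12)
      else 0) ∧
    (∑' l : ℤ√3,
      if 0 < zsqrt3ToReal l ∧
          2 - Real.sqrt 3 < |zsqrt3ToReal l / zsqrt3ToReal (star l)| ∧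
          |zsqrt3ToReal l / zsqrt3ToReal (star l)| ≤ 2 + Real.sqrt 3 then
        (phi0 l : ℂ) *
          Complex.exp (2 * Real.pi * Complex.I * (|Zsqrtd.norm l| : ℤ) * τ / 12)
      else 0) = (dedekindEta τ) ^ 2 := by
  have hterm (l : ℤ√3) : (phi0 l : ℂ) *
      Complex.exp (2 * Real.pi * Complex.I * (|Zsqrtd.norm l| : ℤ) * τ / 12) = heckeTerm τ l := rfl
  simp only [zsqrt3_ratio_cond_iff, hterm]
  have hpos (l : ℤ√3) (h : 0 < l.re ∧ -l.re < 3 * l.im ∧ 3 * l.im ≤ l.re) :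
      l.re ^ 2 + l.im ^ 2 ≤ 3 * |l.norm| := by
    refine le_trans ?_ (mul_le_mul_of_nonneg_left (le_abs_self _) (by norm_num))
    rw [Zsqrtd.norm_def]
    nlinarith
  have hneg (l : ℤ√3) (h : 0 < l.im ∧ -l.im < l.re ∧ l.re ≤ l.im) :
      l.re ^ 2 + l.im ^ 2 ≤ 3 * |l.norm| := by
    refine le_trans ?_ (mul_le_mul_of_nonneg_left (neg_le_abs _) (by norm_num))
    rw [Zsqrtd.norm_def]
    nlinarith
  refine ⟨summable_heckeTerm_of_norm hτ _ fun l h => h.elim (hpos l) (hneg l), ?_⟩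
  have hadd := Summable.tsum_add (summable_heckeTerm_of_norm hτ _ hpos)
    (summable_heckeTerm_of_norm hτ _ hneg)
  rw [tsum_heckeTerm_pos_norm hτ, tsum_heckeTerm_neg_norm, add_zero] at hadd
  rw [← hadd]
  refine tsum_congr fun l => ?_
  split_ifs <;> first | omega | simp
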